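/- arXiv:0710.2101 — 3 statements merged into one kernel-verified Lean document; each statement's English description precedes it below -/
import Mathlib

section
/- For every i ∈ {1,…,6} and every a ∈ ℤ, one has ψᵢ(γ_a) = 0, where γ_a is regarded as an element of V via the inclusion Y ⊆ V. -/
noncomputable section

abbrev Xsp : Type := (ℤ × ℤ) →₀ ℚ
abbrev Ysp : Type := ℤ →₀ ℚ
abbrev V : Type := Xsp × Ysp

/-- The basis vector `X_{a,b}` of `V`. -/
def XB (a b : ℤ) : V := (Finsupp.single (a, b) 1, 0)

/-- The basis vector `Y_d` of `V`. -/
def YB (d : ℤ) : V := (0, Finsupp.single d 1)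

/-- The linear map `V → ℚ` determined on the basis by `X_{a,b} ↦ gX (a,b)`, `Y_d ↦ gY d`. -/
def lmap (gX : ℤ × ℤ → ℚ) (gY : ℤ → ℚ) : V →ₗ[ℚ] ℚ :=
  (Finsupp.linearCombination ℚ gX).comp (LinearMap.fst ℚ Xsp Ysp)
  + (Finsupp.linearCombination ℚ gY).comp (LinearMap.snd ℚ Xsp Ysp)

/-- `ψ₁ : Y_d ↦ 1` for `d` odd, `X_{a,b} ↦ -1` for `a+b` odd, all else to `0`. -/
def psi1 : V →ₗ[ℚ] ℚ :=
  lmap (fun p => if Odd (p.1 + p.2) then -1 else 0) (fun d => if Odd d then 1 else 0)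

/-- `ψ₂ : Y_d ↦ 1` for `d` even, `X_{a,b} ↦ -1` for `a+b` even, all else to `0`. -/
def psi2 : V →ₗ[ℚ] ℚ :=
  lmap (fun p => if Even (p.1 + p.2) then -1 else 0) (fun d => if Even d then 1 else 0)

/-- `ψ₃ : Y_d ↦ d` for `d` odd, `X_{a,b} ↦ -(a+b)` for `a+b` odd, all else to `0`. -/
def psi3 : V →ₗ[ℚ] ℚ :=
  lmap (fun p => if Odd (p.1 + p.2) then -((p.1 : ℚ) + p.2) else 0)
    (fun d => if Odd d then (d : ℚ) else 0)

/-- `ψ₄ : Y_d ↦ d` for `d` even, `X_{a,b} ↦ -(a+b)` for `a+b` even, all else to `0`. -/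
def psi4 : V →ₗ[ℚ] ℚ :=
  lmap (fun p => if Even (p.1 + p.2) then -((p.1 : ℚ) + p.2) else 0)
    (fun d => if Even d then (d : ℚ) else 0)

/-- `ψ₅ : Y_d ↦ 1/d` for `d` odd,
`X_{a,b} ↦ (4(a-b+1) - (a+b)²)/((a+b)((a+b)²-4))` for `a+b` odd, all else to `0`. -/
def psi5 : V →ₗ[ℚ] ℚ :=
  lmap
    (fun p => if Odd (p.1 + p.2) then
        (4 * ((p.1 : ℚ) - p.2 + 1) - ((p.1 : ℚ) + p.2) ^ 2) /
          (((p.1 : ℚ) + p.2) * (((p.1 : ℚ) + p.2) ^ 2 - 4))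
      else 0)
    (fun d => if Odd d then 1 / (d : ℚ) else 0)

/-- `ψ₆ : Y₀ ↦ 1`, `X_{a,b} ↦ b-a-1` for `a+b = 0`, `X_{a,b} ↦ (a-b)/2` for `a+b = ±2`,
all else to `0`. -/
def psi6 : V →ₗ[ℚ] ℚ :=
  lmap
    (fun p => if p.1 + p.2 = 0 then (p.2 : ℚ) - p.1 - 1
      else if p.1 + p.2 = 2 ∨ p.1 + p.2 = -2 then ((p.1 : ℚ) - p.2) / 2 else 0)
    (fun d => if d = 0 then 1 else 0)

/-- The six linear maps `ψ₁, …, ψ₆`. -/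
def psi : Fin 6 → (V →ₗ[ℚ] ℚ) := ![psi1, psi2, psi3, psi4, psi5, psi6]

/-- `γ_a = (-(a-3)/2)·Y_{a-3} + (3(a-1)/2)·Y_{a-1} + (-3(a+1)/2)·Y_{a+1} + ((a+3)/2)·Y_{a+3}`,
regarded as an element of `V` via the inclusion `Y ⊆ V`. -/
def gammaV (a : ℤ) : V :=
  (-((a : ℚ) - 3) / 2) • YB (a - 3) + (3 * ((a : ℚ) - 1) / 2) • YB (a - 1)
    + (-(3 * ((a : ℚ) + 1)) / 2) • YB (a + 1) + (((a : ℚ) + 3) / 2) • YB (a + 3)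

/-- The value of `lmap gX gY` on `Y_d` is `gY d`. -/
theorem lmap_YB (gX : ℤ × ℤ → ℚ) (gY : ℤ → ℚ) (d : ℤ) : lmap gX gY (YB d) = gY d := by
  simp [lmap, YB]

/-- The value of `lmap gX gY` on `γ_a`. -/
theorem lmap_gammaV (gX : ℤ × ℤ → ℚ) (gY : ℤ → ℚ) (a : ℤ) :
    lmap gX gY (gammaV a) =
      -((a : ℚ) - 3) / 2 * gY (a - 3) + 3 * ((a : ℚ) - 1) / 2 * gY (a - 1)
        + -(3 * ((a : ℚ) + 1)) / 2 * gY (a + 1) + ((a : ℚ) + 3) / 2 * gY (a + 3) := by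
  simp only [gammaV, map_add, map_smul, lmap_YB, smul_eq_mul]

/-- A functional of the form `Y_d ↦ f d` for `d` satisfying `P`, and `Y_d ↦ 0` otherwise, kills
`γ_a` when `P` is 2-periodic and `f` itself satisfies the relation. -/
theorem lmap_gammaV_eq_zero_of_periodic (gX : ℤ × ℤ → ℚ) (P : ℤ → Prop) [DecidablePred P]
    (f : ℤ → ℚ) (a : ℤ) (hP : ∀ d, P (d + 2) ↔ P d)
    (hf : P (a - 3) → -((a : ℚ) - 3) / 2 * f (a - 3) + 3 * ((a : ℚ) - 1) / 2 * f (a - 1)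
        + -(3 * ((a : ℚ) + 1)) / 2 * f (a + 1) + ((a : ℚ) + 3) / 2 * f (a + 3) = 0) :
    lmap gX (fun d => if P d then f d else 0) (gammaV a) = 0 := by
  have h1 : P (a - 1) ↔ P (a - 3) := by rw [← hP (a - 3)]; ring_nf
  have h2 : P (a + 1) ↔ P (a - 3) := by rw [← h1, ← hP (a - 1)]; ring_nf
  have h3 : P (a + 3) ↔ P (a - 3) := by rw [← h2, ← hP (a + 1)]; ring_nf
  rw [lmap_gammaV]
  simp only [h1, h2, h3]
  split_ifs with h
  · exact hf h
  · simp

theorem odd_add_two_iff (d : ℤ) : Odd (d + 2) ↔ Odd d := by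
  simp

theorem even_add_two_iff (d : ℤ) : Even (d + 2) ↔ Even d := by
  simp

theorem psi5_gammaV (a : ℤ) : psi5 (gammaV a) = 0 := by
  refine lmap_gammaV_eq_zero_of_periodic _ Odd _ a odd_add_two_iff fun h => ?_
  obtain ⟨k, hk⟩ := h
  have h0 : (a : ℚ) - 3 ≠ 0 := by exact_mod_cast (by omega : a - 3 ≠ 0)
  have h1 : (a : ℚ) - 1 ≠ 0 := by exact_mod_cast (by omega : a - 1 ≠ 0)
  have h2 : (a : ℚ) + 1 ≠ 0 := by exact_mod_cast (by omega : a + 1 ≠ 0)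
  have h3 : (a : ℚ) + 3 ≠ 0 := by exact_mod_cast (by omega : a + 3 ≠ 0)
  push_cast
  field_simp
  ring

theorem psi6_gammaV (a : ℤ) : psi6 (gammaV a) = 0 := by
  have key (d : ℤ) : (d : ℚ) * (if d = 0 then 1 else 0) = 0 := by
    split_ifs with h <;> simp [h]
  rw [psi6, lmap_gammaV]
  have h0 := key (a - 3)
  have h1 := key (a - 1)
  have h2 := key (a + 1)
  have h3 := key (a + 3)
  push_cast at h0 h1 h2 h3
  linear_combination -h0 / 2 + 3 * h1 / 2 - 3 * h2 / 2 + h3 / 2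

theorem stmt6 : ∀ i : Fin 6, ∀ a : ℤ, psi i (gammaV a) = 0 := by
  intro i a
  fin_cases i
  · exact lmap_gammaV_eq_zero_of_periodic _ Odd (fun _ => 1) a odd_add_two_iff fun _ => by ring
  · exact lmap_gammaV_eq_zero_of_periodic _ Even (fun _ => 1) a even_add_two_iff fun _ => by ring
  · exact lmap_gammaV_eq_zero_of_periodic _ Odd (fun d => (d : ℚ)) a odd_add_two_iff
      fun _ => by push_cast; ring
  · exact lmap_gammaV_eq_zero_of_periodic _ Even (fun d => (d : ℚ)) a even_add_two_iff
      fun _ => by push_cast; ring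
  · exact psi5_gammaV a
  · exact psi6_gammaV a
end
end

section
/- For every i ∈ {1,…,6} and all a, b, a', b' ∈ ℤ with a ≡ a' (mod 2) and b ≡ b' (mod 2), one has ηᵢ(vJ⁺(a,b)) = ηᵢ(vJ⁺(a',b')) and ηᵢ(vJᴬ(a,b)) = ηᵢ(vJᴬ(a',b')). -/
noncomputable section

/-- `η₁ : X_{a,b} ↦ (a+b)²` for `a+b` odd, `Y_d ↦ -d²` for `d` odd, all else to `0`. -/
def eta1 : V →ₗ[ℚ] ℚ :=
  lmap (fun p => if Odd (p.1 + p.2) then ((p.1 : ℚ) + p.2) ^ 2 else 0)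
    (fun d => if Odd d then -(d : ℚ) ^ 2 else 0)

/-- `η₂ : X_{a,b} ↦ (a+b)²` for `a+b` even, `Y_d ↦ -d²` for `d` even, all else to `0`. -/
def eta2 : V →ₗ[ℚ] ℚ :=
  lmap (fun p => if Even (p.1 + p.2) then ((p.1 : ℚ) + p.2) ^ 2 else 0)
    (fun d => if Even d then -(d : ℚ) ^ 2 else 0)

/-- `η₃ : X_{a,b} ↦ 1` for `a` even, `b` odd, all else to `0`. -/
def eta3 : V →ₗ[ℚ] ℚ :=
  lmap (fun p => if Even p.1 ∧ Odd p.2 then 1 else 0) (fun _ => 0)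

/-- `η₄ : X_{a,b} ↦ 1` for `a` even, `b` even, all else to `0`. -/
def eta4 : V →ₗ[ℚ] ℚ :=
  lmap (fun p => if Even p.1 ∧ Even p.2 then 1 else 0) (fun _ => 0)

/-- `η₅ : X_{a,b} ↦ 1` for `a` odd, `b` even, all else to `0`. -/
def eta5 : V →ₗ[ℚ] ℚ :=
  lmap (fun p => if Odd p.1 ∧ Even p.2 then 1 else 0) (fun _ => 0)

/-- `η₆ : X_{a,b} ↦ 1` for `a` odd, `b` odd, all else to `0`. -/
def eta6 : V →ₗ[ℚ] ℚ :=
  lmap (fun p => if Odd p.1 ∧ Odd p.2 then 1 else 0) (fun _ => 0)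

/-- The six linear maps `η₁, …, η₆`. -/
def eta : Fin 6 → (V →ₗ[ℚ] ℚ) := ![eta1, eta2, eta3, eta4, eta5, eta6]

/-- `vJ⁺(a,b) = X_{a,b} + X_{b,a} + 2·Y_{a+b}`, the value `F⁽¹⁾(J⁺_{a,b})`. -/
def vJp (a b : ℤ) : V := XB a b + XB b a + (2 : ℚ) • YB (a + b)

/-- `vJᴬ(a,b) = X_{a,b+1} + X_{b,a+1} + Y_{a+b-1} + Y_{a+b+3}`, the value `F⁽¹⁾(J^A_{a,b})`. -/
def vJA (a b : ℤ) : V := XB a (b + 1) + XB b (a + 1) + YB (a + b - 1) + YB (a + b + 3)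

theorem lmap_XB (gX : ℤ × ℤ → ℚ) (gY : ℤ → ℚ) (a b : ℤ) : lmap gX gY (XB a b) = gX (a, b) := by
  simp [lmap, XB]

theorem lmap_vJp (gX : ℤ × ℤ → ℚ) (gY : ℤ → ℚ) (a b : ℤ) :
    lmap gX gY (vJp a b) = gX (a, b) + gX (b, a) + 2 * gY (a + b) := by
  simp only [vJp, map_add, map_smul, lmap_XB, lmap_YB, smul_eq_mul]

theorem lmap_vJA (gX : ℤ × ℤ → ℚ) (gY : ℤ → ℚ) (a b : ℤ) :
    lmap gX gY (vJA a b) =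
      gX (a, b + 1) + gX (b, a + 1) + gY (a + b - 1) + gY (a + b + 3) := by
  simp only [vJA, map_add, lmap_XB, lmap_YB]

theorem Int.ModEq.even_iff_even {a a' : ℤ} (h : a ≡ a' [ZMOD 2]) : Even a ↔ Even a' := by
  rw [Int.even_iff, Int.even_iff, h.eq]

theorem stmt15 : ∀ i : Fin 6, ∀ a b a' b' : ℤ, a ≡ a' [ZMOD 2] → b ≡ b' [ZMOD 2] →
    eta i (vJp a b) = eta i (vJp a' b') ∧ eta i (vJA a b) = eta i (vJA a' b') := by
  intro i a b a' b' ha hb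
  replace ha := ha.even_iff_even
  replace hb := hb.even_iff_even
  have h3 : ¬ Even (3 : ℤ) := by decide
  fin_cases i <;>
    simp only [eta, eta1, eta2, eta3, eta4, eta5, eta6, Fin.zero_eta, Fin.mk_one, Fin.reduceFinMk,
      Matrix.cons_val, lmap_vJp, lmap_vJA, ← Int.not_even_iff_odd, Int.even_add, Int.even_sub,
      Int.not_even_one, h3, ha, hb] <;>
    by_cases hea : Even a' <;> by_cases heb : Even b' <;> simp [hea, heb] <;>
    ring
end
end

section
/- Let W be a ℚ-vector space and let φ : V → W be a ℚ-linear map. Then φ(vJ⁺(a,b)) = 0 and φ(vJᴬ(a,b)) = 0 for all a,b ∈ ℤ if and only if φ(Z_{a,b}) = 0 for all (a,b) ∈ ℤ². -/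
noncomputable section

/-- `Φ_{a,b} = ((a-b)/2)·Y_{a+b-2} + (b-a-1)·Y_{a+b} + ((a-b)/2)·Y_{a+b+2}`. -/
def Phi (a b : ℤ) : V :=
  (((a : ℚ) - b) / 2) • YB (a + b - 2) + ((b : ℚ) - a - 1) • YB (a + b)
    + (((a : ℚ) - b) / 2) • YB (a + b + 2)

/-- `Z_{a,b} = X_{a,b} - Φ_{a,b}`. -/
def Z (a b : ℤ) : V := XB a b - Phi a b

theorem vJp_eq_Z_add_Z (a b : ℤ) : vJp a b = Z a b + Z b a := by
  unfold vJp Z Phi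
  rw [add_comm b a]
  module

theorem vJA_eq_Z_add_Z (a b : ℤ) : vJA a b = Z a (b + 1) + Z b (a + 1) := by
  unfold vJA Z Phi
  rw [show b + (a + 1) = a + (b + 1) by ring, show a + (b + 1) - 2 = a + b - 1 by ring,
    show a + (b + 1) + 2 = a + b + 3 by ring]
  push_cast
  module

/-- A function on `ℤ × ℤ` invariant under `(a, b + 1) ↦ (a + 1, b)` depends only on `a + b`. -/
theorem eq_zero_add_of_shift {α : Type*} {f : ℤ → ℤ → α}
    (h : ∀ a b, f a (b + 1) = f (a + 1) b) (a b : ℤ) : f a b = f 0 (a + b) := by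
  induction a using Int.induction_on generalizing b with
  | zero => simp
  | succ n ih => rw [← h, ih, add_right_comm, add_assoc]
  | pred n ih =>
    have hshift := h (-(n : ℤ) - 1) (b - 1)
    rw [sub_add_cancel, sub_add_cancel, ih] at hshift
    rw [hshift]
    congr 1
    ring

theorem stmt17 {W : Type*} [AddCommGroup W] [Module ℚ W] (phi : V →ₗ[ℚ] W) :
    (∀ a b : ℤ, phi (vJp a b) = 0 ∧ phi (vJA a b) = 0) ↔ (∀ a b : ℤ, phi (Z a b) = 0) := by
  simp only [vJp_eq_Z_add_Z, vJA_eq_Z_add_Z, map_add]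
  constructor
  · intro h a b
    have hanti (a b : ℤ) : phi (Z a b) = -phi (Z b a) := eq_neg_of_add_eq_zero_left (h a b).1
    have hshift (a b : ℤ) : phi (Z a (b + 1)) = phi (Z (a + 1) b) := by
      rw [eq_neg_of_add_eq_zero_left (h a b).2, ← hanti]
    have hsum := eq_zero_add_of_shift (f := fun a b => phi (Z a b)) hshift
    have hsymm : phi (Z a b) = phi (Z b a) := by
      rw [hsum a b, hsum b a, add_comm]
    have hdouble : (2 : ℚ) • phi (Z a b) = 0 := by
      rw [two_smul]
      nth_rewrite 2 [hsymm]
      exact (h a b).1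
    exact (smul_eq_zero.mp hdouble).resolve_left two_ne_zero
  · intro h a b
    simp [h]
end
end
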